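/- arXiv:2304.07674 — 2 statements merged into one kernel-verified Lean document; each statement's English description precedes it below -/
import Mathlib

section
/- Let G=(V,E) be a finite connected graph, let x be a point of the spanning tree polytope of G, and let η > 0. Let L' be a laminar family of nonempty subsets of V with V ∈ L', such that every S ∈ L' is η-well-connected with respect to x, i.e., η·x(δ_{G[S]}(Q)) ≥ |Q| − 1 for every partition Q of S into nonempty parts. Then there exists a point x' of the spanning tree polytope of G with x'(e) ≤ η·x(e) for all e ∈ E, such that x' is L'-aligned: for every S ∈ L', the restriction of x' to E(S) lies in the spanning tree polytope of G[S]. -/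
open scoped Classical
open Finset

noncomputable section

variable {V : Type}

/-- The set of edges of `G` with exactly one endpoint in `S`. -/
def cutEdges [Fintype V] (G : SimpleGraph V) (S : Set V) : Finset (Sym2 V) :=
  Finset.univ.filter (fun e => e ∈ G.edgeSet ∧ ∃ u v, e = s(u, v) ∧ u ∈ S ∧ v ∉ S)

/-- The set of edges of `G` with both endpoints in `S`. -/
def insideEdges [Fintype V] (G : SimpleGraph V) (S : Set V) : Finset (Sym2 V) :=
  Finset.univ.filter (fun e => e ∈ G.edgeSet ∧ ∀ v ∈ e, v ∈ S)

/-- A family of sets is laminar if any two members are disjoint or nested. -/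
def Laminar (L : Set (Set V)) : Prop :=
  ∀ S T, S ∈ L → T ∈ L → S ∩ T = ∅ ∨ S ∩ T = S ∨ S ∩ T = T

/-- The spanning tree polytope of `G` : the convex hull of the indicator vectors of
the edge sets of spanning trees of `G`. -/
def stPolytope [Fintype V] (G : SimpleGraph V) : Set (Sym2 V → ℝ) :=
  convexHull ℝ { y | ∃ T : SimpleGraph V, T ≤ G ∧ T.IsTree ∧
      y = fun e => if e ∈ T.edgeSet then (1 : ℝ) else 0 }

/-- `x` is `L`-aligned: for every `S ∈ L`, the restriction of `x` to `E(S)` lies in the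
spanning tree polytope of the induced subgraph `G[S]`. -/
def IsAligned [Fintype V] (G : SimpleGraph V) (L : Set (Set V)) (x : Sym2 V → ℝ) : Prop :=
  ∀ S ∈ L, (fun e : Sym2 S => x (e.map Subtype.val)) ∈ stPolytope (G.induce S)

/-- `P` is a partition of `S` into (pairwise disjoint) nonempty parts. -/
def IsPartitionOf (S : Set V) (P : Finset (Set V)) : Prop :=
  (∀ p ∈ P, p.Nonempty) ∧ ((P : Set (Set V)).Pairwise Disjoint) ∧ (⋃ p ∈ P, p) = S

/-- The set of edges of `G` whose two endpoints lie in two different parts of `P`. -/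
def partitionCut [Fintype V] (G : SimpleGraph V) (P : Finset (Set V)) : Finset (Sym2 V) :=
  Finset.univ.filter (fun e => e ∈ G.edgeSet ∧
    ∃ u v, e = s(u, v) ∧ ∃ p ∈ P, ∃ q ∈ P, p ≠ q ∧ u ∈ p ∧ v ∈ q)

/-- `S` is `η`-well-connected with respect to `x`: for every partition `Q` of `S` into
nonempty parts, `η·x(δ_{G[S]}(Q)) ≥ |Q| − 1`. -/
def WellConnected [Fintype V] (G : SimpleGraph V) (x : Sym2 V → ℝ) (η : ℝ) (S : Set V) :
    Prop :=
  ∀ Q : Finset (Set V), IsPartitionOf S Q →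
    (Q.card : ℝ) - 1 ≤ η * ∑ e ∈ partitionCut G Q, x e

lemma SimpleGraph.card_le_ncard_edgeSet_add_card_connectedComponent {U : Type*} [Finite U]
    [Nonempty U] (F : SimpleGraph U) :
    Nat.card U ≤ F.edgeSet.ncard + Nat.card F.ConnectedComponent := by
  let rep : F.ConnectedComponent → U := fun c => Quot.out c
  have hrep : ∀ v, F.Reachable (rep (F.connectedComponentMk v)) v := fun v =>
    SimpleGraph.ConnectedComponent.exact (Quot.out_eq (F.connectedComponentMk v))
  let c₀ := F.connectedComponentMk (Classical.arbitrary U)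
  let star : Set (Sym2 U) := (fun c => s(rep c₀, rep c)) '' {c₀}ᶜ
  have hconn : (F ⊔ SimpleGraph.fromEdgeSet star).Connected := by
    rw [SimpleGraph.connected_iff_exists_forall_reachable]
    refine ⟨rep c₀, fun v => ?_⟩
    refine SimpleGraph.Reachable.trans ?_ ((hrep v).mono le_sup_left)
    by_cases h : rep c₀ = rep (F.connectedComponentMk v)
    · rw [h]
    · refine SimpleGraph.Adj.reachable (Or.inr ?_)
      rw [SimpleGraph.fromEdgeSet_adj]
      exact ⟨⟨_, fun hc => h (congrArg rep hc).symm, rfl⟩, h⟩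
  have h1 := hconn.card_vert_le_card_edgeSet_add_one
  rw [Nat.card_coe_set_eq] at h1
  have h2 : (F ⊔ SimpleGraph.fromEdgeSet star).edgeSet.ncard ≤ F.edgeSet.ncard + star.ncard := by
    refine le_trans (Set.ncard_le_ncard ?_ (Set.toFinite _)) (Set.ncard_union_le _ _)
    rw [SimpleGraph.edgeSet_sup, SimpleGraph.edgeSet_fromEdgeSet]
    exact Set.union_subset_union_right _ Set.sdiff_subset
  have h3 : star.ncard ≤ ({c₀}ᶜ : Set F.ConnectedComponent).ncard :=
    Set.ncard_image_le (Set.toFinite _)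
  have h4 := Set.ncard_add_ncard_compl ({c₀} : Set F.ConnectedComponent)
  rw [Set.ncard_singleton] at h4
  omega

lemma SimpleGraph.IsTree.ncard_edgeSet_sdiff_lt {U : Type*} [Finite U] {T F : SimpleGraph U}
    (hT : T.IsTree) (hF : F ≤ T) :
    (T.edgeSet \ F.edgeSet).ncard < Nat.card F.ConnectedComponent := by
  have := Fintype.ofFinite U
  have := hT.connected.nonempty
  have h1 := F.card_le_ncard_edgeSet_add_card_connectedComponent
  have h2 := hT.card_edgeFinset
  rw [← Set.ncard_coe_finset, SimpleGraph.coe_edgeFinset, ← Nat.card_eq_fintype_card] at h2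
  have h3 := Set.ncard_sdiff_add_ncard_of_subset (SimpleGraph.edgeSet_mono hF)
  omega

/-- A monotone family of graphs has a common forest that spans each member. -/
lemma SimpleGraph.exists_isAcyclic_forall_reachable_inf_eq {V κ : Type*} [Finite V] [LinearOrder κ]
    [Nonempty κ] (H : κ → SimpleGraph V) (hH : Monotone H) :
    ∃ T : SimpleGraph V, T.IsAcyclic ∧ (∃ k, T ≤ H k) ∧
      ∀ k, (T ⊓ H k).Reachable = (H k).Reachable := by
  have key : ∀ K : Finset κ, ∃ T : SimpleGraph V, T.IsAcyclic ∧
      (∀ a, (∀ k ∈ K, k ≤ a) → T ≤ H a) ∧ ∀ k ∈ K, (T ⊓ H k).Reachable = (H k).Reachable := by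
    intro K
    induction K using Finset.induction_on_max with
    | empty => exact ⟨⊥, SimpleGraph.isAcyclic_bot, fun _ _ => bot_le, by simp⟩
    | insert a s hs ih =>
      obtain ⟨T, hT, hle, hreach⟩ := ih
      obtain ⟨T', hTT', hT'a, hT', hr⟩ :=
        SimpleGraph.exists_isAcyclic_reachable_eq_le_of_le_of_isAcyclic
          (hle a fun k hk => (hs k hk).le) hT
      refine ⟨T', hT', fun b hb => hT'a.trans (hH (hb a (mem_insert_self a s))), fun k hk => ?_⟩
      rcases mem_insert.mp hk with rfl | hk
      · rw [inf_eq_left.mpr hT'a, hr]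
      · ext u v
        refine ⟨fun h => h.mono inf_le_right, fun h => ?_⟩
        rw [← hreach k hk] at h
        exact h.mono (inf_le_inf_right _ hTT')
  have := Fintype.ofFinite (SimpleGraph V)
  let K : Finset κ := univ.image (Function.invFun H)
  obtain ⟨T, hT, hle, hreach⟩ := key K
  refine ⟨T, hT, ?_, fun k => ?_⟩
  · exact ⟨K.max' (univ_nonempty.image _), hle _ fun k hk => K.le_max' k hk⟩
  · have h := hreach (Function.invFun H (H k)) (mem_image_of_mem _ (mem_univ _))
    rwa [Function.invFun_eq (f := H) ⟨k, rfl⟩] at h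

lemma SimpleGraph.reachable_induce_of_forall_adj {V : Type*} {K : SimpleGraph V} {S : Set V}
    (hS : ∀ u v, K.Adj u v → u ∈ S → v ∈ S) {u v : V} (h : K.Reachable u v) (hu : u ∈ S)
    (hv : v ∈ S) : (K.induce S).Reachable ⟨u, hu⟩ ⟨v, hv⟩ := by
  obtain ⟨p⟩ := h
  induction p with
  | nil => rfl
  | @cons a b c hab p ih =>
    have hb := hS a b hab hu
    exact (SimpleGraph.Adj.reachable (G := K.induce S) (u := ⟨a, hu⟩) (v := ⟨b, hb⟩) hab).trans
      (ih hb hv)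

/-- If every superlevel sum of `c` with respect to `w ≥ 0` is nonnegative, then so is the
`w`-weighted sum of `c`. -/
lemma Finset.sum_mul_nonneg_of_superlevel_sum_nonneg {α : Type*} (E : Finset α) (w c : α → ℝ)
    (hw : ∀ e ∈ E, 0 ≤ w e) (hc : ∀ t, 0 ≤ t → 0 ≤ ∑ e ∈ E with t < w e, c e) :
    0 ≤ ∑ e ∈ E, w e * c e := by
  induction hn : #{e ∈ E | 0 < w e} using Nat.strong_induction_on generalizing w with
  | _ n ih =>
  rcases ({e ∈ E | 0 < w e}).eq_empty_or_nonempty with h | h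
  · rw [filter_eq_empty_iff] at h
    refine sum_nonneg fun e he => ?_
    rw [le_antisymm (not_lt.mp (h he)) (hw e he), zero_mul]
  · obtain ⟨i, hi, hmin⟩ := exists_min_image _ w h
    have hi0 : 0 < w i := (mem_filter.mp hi).2
    have hmin' : ∀ e ∈ E, 0 < w e → w i ≤ w e := fun e he h => hmin e (mem_filter.mpr ⟨he, h⟩)
    let w' : α → ℝ := fun e => if 0 < w e then w e - w i else 0
    have hlevel : ∀ t, 0 ≤ t → ∀ e, t < w' e ↔ t + w i < w e := by
      intro t ht e
      simp only [w']
      split_ifs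
      · exact lt_sub_iff_add_lt
      · constructor <;> intro <;> linarith
    have h' : 0 ≤ ∑ e ∈ E, w' e * c e := by
      refine ih _ ?_ w' ?_ ?_ rfl
      · rw [← hn]
        refine card_lt_card ((ssubset_iff_of_subset fun e => ?_).mpr ⟨i, hi, ?_⟩)
        · simp only [mem_filter, hlevel 0 le_rfl]
          exact fun h => ⟨h.1, by linarith [h.2]⟩
        · simp [hlevel 0 le_rfl]
      · intro e he
        simp only [w']
        split_ifs with h
        · linarith [hmin' e he h]
        · rfl
      · intro t ht
        simp only [hlevel t ht]
        exact hc _ (by linarith)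
    have hsplit : ∑ e ∈ E, w e * c e
        = ∑ e ∈ E, w' e * c e + w i * ∑ e ∈ E with 0 < w e, c e := by
      rw [mul_sum, sum_filter, ← sum_add_distrib]
      refine sum_congr rfl fun e he => ?_
      simp only [w']
      split_ifs with h
      · ring
      · rw [le_antisymm (not_lt.mp h) (hw e he)]; ring
    rw [hsplit]
    exact add_nonneg h' (mul_nonneg hi0.le (hc 0 le_rfl))

lemma stPolytope_nonneg [Fintype V] {G : SimpleGraph V} {x : Sym2 V → ℝ} (hx : x ∈ stPolytope G)
    (e : Sym2 V) : 0 ≤ x e := by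
  have hconv : Convex ℝ {y : Sym2 V → ℝ | 0 ≤ y} := convex_Ici (0 : Sym2 V → ℝ)
  refine convexHull_min ?_ hconv hx e
  rintro _ ⟨T, -, -, rfl⟩ e
  dsimp only
  split_ifs <;> simp

/-- Well-connectedness applied to the partition of `S` into the components of a graph on `S`. -/
lemma WellConnected.card_connectedComponent_sub_one_le [Fintype V] {G : SimpleGraph V}
    {x : Sym2 V → ℝ} {η : ℝ} {S : Set V} (hwc : WellConnected G x η S) (hη : 0 ≤ η)
    (hx : ∀ e, 0 ≤ x e) (H : SimpleGraph S) (A : Finset (Sym2 V))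
    (hA : ∀ u v : S, G.Adj u v → ¬ H.Reachable u v → s((u : V), (v : V)) ∈ A) :
    (Nat.card H.ConnectedComponent : ℝ) - 1 ≤ η * ∑ e ∈ A, x e := by
  have := Fintype.ofFinite H.ConnectedComponent
  let part : H.ConnectedComponent → Set V := fun c => Subtype.val '' c.supp
  have hpart : ∀ (u : S) c, (u : V) ∈ part c ↔ H.connectedComponentMk u = c := by
    intro u c
    simp [part]
  have hinj : Function.Injective part := by
    intro c d h
    obtain ⟨u, rfl⟩ := c.exists_rep
    have : (u : V) ∈ part d := h ▸ (hpart u _).mpr rfl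
    exact (hpart u d).mp this
  let Q : Finset (Set V) := univ.image part
  have hcard : Q.card = Nat.card H.ConnectedComponent := by
    rw [card_image_of_injective _ hinj, card_univ, Nat.card_eq_fintype_card]
  have hQ : IsPartitionOf S Q := by
    refine ⟨?_, ?_, ?_⟩
    · intro p hp
      obtain ⟨c, -, rfl⟩ := mem_image.mp hp
      exact c.nonempty_supp.image _
    · intro p hp q hq hpq
      obtain ⟨c, -, rfl⟩ := mem_image.mp hp
      obtain ⟨d, -, rfl⟩ := mem_image.mp hq
      rw [Set.disjoint_left]
      rintro _ ⟨u, hu, rfl⟩ hd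
      exact hpq (congrArg part (((hpart u c).mp ⟨u, hu, rfl⟩).symm.trans ((hpart u d).mp hd)))
    · ext v
      simp only [Set.mem_iUnion]
      constructor
      · rintro ⟨p, hp, hv⟩
        obtain ⟨c, -, rfl⟩ := mem_image.mp hp
        obtain ⟨u, -, rfl⟩ := hv
        exact u.2
      · exact fun hv => ⟨_, mem_image_of_mem part (mem_univ _), (hpart ⟨v, hv⟩ _).mpr rfl⟩
  have h := hwc Q hQ
  rw [hcard] at h
  refine h.trans (mul_le_mul_of_nonneg_left ?_ hη)
  refine sum_le_sum_of_subset_of_nonneg ?_ fun e _ _ => hx e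
  intro e he
  obtain ⟨heG, u, v, rfl, p, hp, q, hq, hpq, hu, hv⟩ := (mem_filter.mp he).2
  obtain ⟨c, -, rfl⟩ := mem_image.mp hp
  obtain ⟨d, -, rfl⟩ := mem_image.mp hq
  obtain ⟨u, hu, rfl⟩ := hu
  obtain ⟨v, hv, rfl⟩ := hv
  refine hA u v heG fun hr => hpq (congrArg part ?_)
  rw [SimpleGraph.ConnectedComponent.mem_supp_iff] at hu hv
  rw [← hu, ← hv]
  exact SimpleGraph.ConnectedComponent.sound hr

lemma WellConnected.connected_induce [Fintype V] {G : SimpleGraph V}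
    {x : Sym2 V → ℝ} {η : ℝ} {S : Set V} (hwc : WellConnected G x η S) (hη : 0 ≤ η)
    (hx : ∀ e, 0 ≤ x e) (hS : S.Nonempty) : (G.induce S).Connected := by
  have h := hwc.card_connectedComponent_sub_one_le hη hx (G.induce S) ∅ fun u v huv hr =>
    absurd (SimpleGraph.Adj.reachable (G := G.induce S) huv) hr
  rw [sum_empty, mul_zero, sub_nonpos, Nat.cast_le_one] at h
  have := hS.to_subtype
  have := Finite.card_le_one_iff_subsingleton.mp h
  exact ⟨fun u v => SimpleGraph.ConnectedComponent.exact (Subsingleton.elim _ _)⟩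

lemma mem_edgeSet_induce_iff {T : SimpleGraph V} {S : Set V} (e : Sym2 S) :
    e ∈ (T.induce S).edgeSet ↔ e.map Subtype.val ∈ T.edgeSet := by
  induction e with
  | _ u v => rfl

/-- For nonnegative weights `w`, a Kruskal tree for the order that first compares the sizes of
the smallest members of `L'` containing the edges and then their weights is `L'`-aligned and has
weight at most that of `η • x`. -/
lemma exists_aligned_tree_weight_le [Fintype V] (G : SimpleGraph V) (x : Sym2 V → ℝ)
    (hx : ∀ e, 0 ≤ x e) (η : ℝ) (hη : 0 ≤ η) (L' : Set (Set V)) (hL' : Laminar L')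
    (hLne : ∀ S ∈ L', S.Nonempty) (hV : (Set.univ : Set V) ∈ L')
    (hwc : ∀ S ∈ L', WellConnected G x η S) (w : Sym2 V → ℝ) (hw : ∀ e, 0 ≤ w e) :
    ∃ T ≤ G, T.IsTree ∧ (∀ S ∈ L', (T.induce S).IsTree) ∧
      ∑ e, w e * (if e ∈ T.edgeSet then (1 : ℝ) else 0) ≤ ∑ e, w e * (η * x e) := by
  have hmin : ∀ e : Sym2 V, ∃ S ∈ L', (∀ v ∈ e, v ∈ S) ∧
      ∀ S' ∈ L', (∀ v ∈ e, v ∈ S') → S.ncard ≤ S'.ncard := by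
    intro e
    obtain ⟨S, hS, h⟩ := Set.exists_min_image {S ∈ L' | ∀ v ∈ e, v ∈ S} Set.ncard
      (Set.toFinite _) ⟨Set.univ, hV, fun _ _ => Set.mem_univ _⟩
    exact ⟨S, hS.1, hS.2, fun S' h1 h2 => h S' ⟨h1, h2⟩⟩
  choose D hDL hDe hDmin using hmin
  -- nested members of the family that share a point, ordered by size
  have hsub : ∀ S ∈ L', ∀ S' ∈ L', ∀ u, u ∈ S → u ∈ S' → S.ncard ≤ S'.ncard → S ⊆ S' := by
    intro S hS S' hS' u hu hu' hle
    rcases hL' S S' hS hS' with h | h | h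
    · exact absurd (h ▸ ⟨hu, hu'⟩ : u ∈ (∅ : Set V)) (Set.notMem_empty u)
    · exact Set.inter_eq_left.mp h
    · exact (Set.eq_of_subset_of_ncard_le (Set.inter_eq_right.mp h) hle (Set.toFinite _)).ge
  let key : Sym2 V → ℕ ×ₗ ℝ := fun e => toLex ((D e).ncard, w e)
  let H : ℕ ×ₗ ℝ → SimpleGraph V := fun k =>
    { Adj := fun u v => G.Adj u v ∧ key s(u, v) ≤ k
      symm := ⟨fun u v h => ⟨h.1.symm, Sym2.eq_swap (a := u) (b := v) ▸ h.2⟩⟩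
      loopless := ⟨fun u h => G.loopless.irrefl u h.1⟩ }
  obtain ⟨T, hTac, ⟨k₀, hTk⟩, hreach⟩ := SimpleGraph.exists_isAcyclic_forall_reachable_inf_eq H
    fun k k' hk u v h => ⟨h.1, h.2.trans hk⟩
  have hTG : T ≤ G := fun u v h => (hTk h).1
  -- low levels do not leave `S`
  have hclosed : ∀ S ∈ L', ∀ t u v, (H (toLex (S.ncard, t))).Adj u v → u ∈ S → v ∈ S := by
    intro S hS t u v h hu
    have hle := (Prod.Lex.toLex_le_toLex'.mp h.2).1
    exact hsub _ (hDL _) S hS u (hDe _ u (by simp)) hu hle (hDe _ v (by simp))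
  have hreachS : ∀ S ∈ L', ∀ t (u v : S), G.Adj u v → key s((u : V), (v : V)) ≤ toLex (S.ncard, t) →
      ((T ⊓ H (toLex (S.ncard, t))).induce S).Reachable u v := by
    intro S hS t u v huv hle
    refine SimpleGraph.reachable_induce_of_forall_adj (K := T ⊓ H (toLex (S.ncard, t)))
      (fun a b hab => hclosed S hS t a b hab.2) ?_ u.2 v.2
    rw [hreach]
    exact SimpleGraph.Adj.reachable ⟨huv, hle⟩
  have hDle : ∀ S ∈ L', ∀ u v : S, (D s((u : V), (v : V))).ncard ≤ S.ncard := by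
    intro S hS u v
    refine hDmin _ S hS fun a ha => ?_
    rcases Sym2.mem_iff.mp ha with rfl | rfl
    exacts [u.2, v.2]
  have htree : ∀ S ∈ L', (T.induce S).IsTree := by
    intro S hS
    refine ⟨?_, hTac.induce S⟩
    have hc := (hwc S hS).connected_induce hη hx (hLne S hS)
    have := hc.nonempty
    refine ⟨fun u v => ?_⟩
    obtain ⟨p⟩ := hc.preconnected u v
    induction p with
    | nil => rfl
    | @cons a b c hab p ih =>
      refine SimpleGraph.Reachable.trans ?_ ih
      refine (hreachS S hS (w s((a : V), (b : V))) a b hab ?_).mono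
        (SimpleGraph.comap_monotone _ inf_le_left)
      exact Prod.Lex.toLex_le_toLex'.mpr ⟨hDle S hS a b, fun _ => le_rfl⟩
  have huniv : T.IsTree := (SimpleGraph.induceUnivIso T).isTree_iff.mp (htree _ hV)
  refine ⟨T, hTG, huniv, htree, ?_⟩
  have hfiber : ∀ S t, ∑ e with D e = S ∧ t < w e, (if e ∈ T.edgeSet then (1 : ℝ) else 0)
      ≤ ∑ e with D e = S ∧ t < w e, η * x e := by
    intro S t
    by_cases hS : S ∈ L'
    swap
    · have : (univ.filter fun e => D e = S ∧ t < w e) = ∅ :=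
        filter_eq_empty_iff.mpr fun e _ h => hS (h.1 ▸ hDL e)
      rw [this, sum_empty, sum_empty]
    set A : Finset (Sym2 V) := univ.filter fun e => D e = S ∧ t < w e
    set F := (T ⊓ H (toLex (S.ncard, t))).induce S
    have hFT : F ≤ T.induce S := fun _ _ h => h.1
    have hlt := (htree S hS).ncard_edgeSet_sdiff_lt hFT
    have hcount : #{e ∈ A | e ∈ T.edgeSet} ≤ ((T.induce S).edgeSet \ F.edgeSet).ncard := by
      rw [← Set.ncard_coe_finset]
      refine le_trans (Set.ncard_le_ncard ?_ (Set.toFinite _))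
        (Set.ncard_image_le (f := Sym2.map Subtype.val) (Set.toFinite _))
      intro e he
      obtain ⟨hA, heT⟩ := mem_filter.mp (mem_coe.mp he)
      obtain ⟨-, hD, ht⟩ := mem_filter.mp hA
      have heS := hDe e
      rw [hD] at heS
      induction e with
      | _ u v =>
        refine ⟨s(⟨u, heS u (by simp)⟩, ⟨v, heS v (by simp)⟩), ⟨heT, fun hF => ?_⟩, rfl⟩
        have hle : key s(u, v) ≤ toLex (S.ncard, t) := hF.2.2
        exact absurd ((Prod.Lex.toLex_le_toLex'.mp hle).2 (congrArg Set.ncard hD)) (not_le.mpr ht)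
    have hcomp := (hwc S hS).card_connectedComponent_sub_one_le hη hx F A ?_
    · rw [← sum_filter, sum_const, nsmul_eq_mul, mul_one, ← mul_sum]
      refine le_trans ?_ hcomp
      rw [le_sub_iff_add_le]
      exact_mod_cast hcount.trans_lt hlt
    · intro u v huv hr
      have hnle : ¬ key s((u : V), (v : V)) ≤ toLex (S.ncard, t) :=
        fun h => hr (hreachS S hS t u v huv h)
      rw [Prod.Lex.toLex_le_toLex'] at hnle
      push Not at hnle
      obtain ⟨hcard, ht⟩ := hnle (hDle S hS u v)
      refine mem_filter.mpr ⟨mem_univ _, ?_, ht⟩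
      exact Set.eq_of_subset_of_ncard_le
        (hsub _ (hDL _) S hS u (hDe _ u (by simp)) u.2 hcard.le) hcard.ge (Set.toFinite _)
  rw [← sub_nonneg, ← sum_sub_distrib]
  simp only [← mul_sub]
  refine sum_mul_nonneg_of_superlevel_sum_nonneg _ _ _ (fun e _ => hw e) fun t _ => ?_
  rw [sum_sub_distrib, sub_nonneg, ← sum_fiberwise _ D, ← sum_fiberwise _ D]
  refine sum_le_sum fun S _ => ?_
  simp only [filter_filter, and_comm (a := t < _)]
  exact hfiber S t

/-- A finite set of points of which every nonnegative functional is at most its value at `b`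
somewhere has a convex combination dominated by `b`. -/
lemma exists_mem_convexHull_le_of_forall_weight {ι : Type*} [Fintype ι] {A : Set (ι → ℝ)}
    (hA : A.Finite) (b : ι → ℝ)
    (h : ∀ w : ι → ℝ, (∀ i, 0 ≤ w i) → ∃ a ∈ A, ∑ i, w i * a i ≤ ∑ i, w i * b i) :
    ∃ y ∈ convexHull ℝ A, y ≤ b := by
  by_contra! hne
  obtain ⟨f, r, s, hr, hrs, hs⟩ := geometric_hahn_banach_compact_closed (convex_convexHull ℝ A)
    (hA.isCompact_convexHull (𝕜 := ℝ)) (convex_Iic b) isClosed_Iic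
    (Set.disjoint_left.mpr fun y hy hyb => hne y hy hyb)
  have hf : ∀ y, f y = ∑ i, f (Pi.single i 1) * y i := by
    intro y
    conv_lhs => rw [← Finset.univ_sum_single y, map_sum]
    refine sum_congr rfl fun i _ => ?_
    have : Pi.single i (y i) = y i • (Pi.single i 1 : ι → ℝ) := by
      rw [← Pi.single_smul, smul_eq_mul, mul_one]
    rw [this, map_smul, smul_eq_mul, mul_comm]
  have hneg : ∀ i, f (Pi.single i 1) ≤ 0 := by
    intro i
    by_contra! hpos
    obtain ⟨n, hn⟩ := Archimedean.arch (f b - s) hpos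
    have hle : b - (n : ℝ) • (Pi.single i 1 : ι → ℝ) ≤ b :=
      sub_le_self _ (smul_nonneg n.cast_nonneg (Pi.single_nonneg.mpr zero_le_one))
    have := hs _ hle
    rw [map_sub, map_smul, smul_eq_mul] at this
    rw [nsmul_eq_mul] at hn
    linarith
  obtain ⟨a, ha, hab⟩ := h (fun i => - f (Pi.single i 1)) fun i => neg_nonneg.mpr (hneg i)
  simp only [neg_mul, sum_neg_distrib, ← hf] at hab
  linarith [hr a (subset_convexHull ℝ A ha), hs b Set.self_mem_Iic]

/-- a laminar family of `η`-well-connected sets admits an `L'`-aligned point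
dominated by `η·x`. -/
theorem exists_aligned_point_of_wellConnected [Fintype V] (G : SimpleGraph V)
    (hG : G.Connected) (x : Sym2 V → ℝ) (hx : x ∈ stPolytope G) (η : ℝ) (hη : 0 < η)
    (L' : Set (Set V)) (hL' : Laminar L') (hLne : ∀ S ∈ L', S.Nonempty)
    (hV : (Set.univ : Set V) ∈ L')
    (hwc : ∀ S ∈ L', WellConnected G x η S) :
    ∃ x' ∈ stPolytope G, (∀ e ∈ G.edgeSet, x' e ≤ η * x e) ∧ IsAligned G L' x' := by
  have hx0 := stPolytope_nonneg hx
  let A : Set (Sym2 V → ℝ) := { y | ∃ T : SimpleGraph V, T ≤ G ∧ T.IsTree ∧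
    (∀ S ∈ L', (T.induce S).IsTree) ∧ y = fun e => if e ∈ T.edgeSet then (1 : ℝ) else 0 }
  have hA : A.Finite := by
    refine (Set.finite_range fun (T : SimpleGraph V) (e : Sym2 V) =>
      if e ∈ T.edgeSet then (1 : ℝ) else 0).subset ?_
    rintro _ ⟨T, -, -, -, rfl⟩
    exact ⟨T, rfl⟩
  obtain ⟨x', hx', hle⟩ := exists_mem_convexHull_le_of_forall_weight hA (fun e => η * x e) <| by
    intro w hw
    obtain ⟨T, hTG, hT, hTS, hwT⟩ :=
      exists_aligned_tree_weight_le G x hx0 η hη.le L' hL' hLne hV hwc w hw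
    exact ⟨_, ⟨T, hTG, hT, hTS, rfl⟩, hwT⟩
  refine ⟨x', ?_, fun e _ => hle e, fun S hS => ?_⟩
  · refine convexHull_mono ?_ hx'
    rintro _ ⟨T, hTG, hT, -, rfl⟩
    exact ⟨T, hTG, hT, rfl⟩
  · refine convexHull_min ?_ ((convex_convexHull ℝ _).linear_preimage
      (LinearMap.funLeft ℝ ℝ (Sym2.map (Subtype.val : S → V)))) hx'
    rintro _ ⟨T, hTG, -, hTS, rfl⟩
    refine subset_convexHull ℝ _ ⟨T.induce S, fun _ _ h => hTG h, hTS S hS, ?_⟩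
    funext e
    simp only [LinearMap.funLeft_apply, mem_edgeSet_induce_iff]
end
end

section
/- Let G=(V,E) be a finite graph, let x : E → ℝ≥0, let η > 2, let S ⊆ V, and let P = {S₁, …, S_ℓ} be a partition of S into nonempty parts such that η·x(δ_{G[S]}(P)) ≤ ℓ − 1 and x(δ(Sᵢ)) ≥ 1 for each i. Then Σ_{i=1}^{ℓ} x(δ(Sᵢ)) ≤ (1/(1−2/η))·x(δ(S)) − 2/(η−2). -/
open scoped Classical
open Finset

noncomputable section

variable {V : Type}

theorem mem_cutEdges_mk [Fintype V] {G : SimpleGraph V} {S : Set V} {u v : V} :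
    s(u, v) ∈ cutEdges G S ↔ G.Adj u v ∧ (u ∈ S ∧ v ∉ S ∨ v ∈ S ∧ u ∉ S) := by
  simp only [cutEdges, Finset.mem_filter, Finset.mem_univ, true_and, SimpleGraph.mem_edgeSet,
    Sym2.eq_iff]
  grind

theorem mem_partitionCut_mk [Fintype V] {G : SimpleGraph V} {P : Finset (Set V)} {u v : V} :
    s(u, v) ∈ partitionCut G P ↔
      G.Adj u v ∧ ∃ p ∈ P, ∃ q ∈ P, p ≠ q ∧ u ∈ p ∧ v ∈ q := by
  simp only [partitionCut, Finset.mem_filter, Finset.mem_univ, true_and,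
    SimpleGraph.mem_edgeSet, Sym2.eq_iff]
  grind

theorem IsPartitionOf.eq_of_mem {S : Set V} {P : Finset (Set V)} (hP : IsPartitionOf S P)
    {p q : Set V} (hp : p ∈ P) (hq : q ∈ P) {u : V} (hup : u ∈ p) (huq : u ∈ q) : p = q := by
  by_contra hne
  exact Set.disjoint_left.mp (hP.2.1 hp hq hne) hup huq

theorem IsPartitionOf.mem_iff {S : Set V} {P : Finset (Set V)} (hP : IsPartitionOf S P)
    {u : V} : u ∈ S ↔ ∃ p ∈ P, u ∈ p := by
  rw [← hP.2.2]
  simp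

/-- An edge lies in the cuts of at most two parts, and of at most one part if its endpoints are
not in two different parts. -/
theorem IsPartitionOf.card_filter_mem_cutEdges_le [Fintype V] (G : SimpleGraph V) {S : Set V}
    {P : Finset (Set V)} (hP : IsPartitionOf S P) (e : Sym2 V) :
    (P.filter (fun p => e ∈ cutEdges G p)).card ≤
      (if e ∈ cutEdges G S then 1 else 0) + 2 * (if e ∈ partitionCut G P then 1 else 0) := by
  induction e using Sym2.ind with | _ u v
  by_cases hcut : s(u, v) ∈ partitionCut G P
  · obtain ⟨-, p, hp, q, hq, -, hu, hv⟩ := mem_partitionCut_mk.mp hcut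
    have hsub : P.filter (fun r => s(u, v) ∈ cutEdges G r) ⊆ {p, q} := by
      intro r hr
      obtain ⟨hr, hre⟩ := Finset.mem_filter.mp hr
      rw [Finset.mem_insert, Finset.mem_singleton]
      rcases (mem_cutEdges_mk.mp hre).2 with h | h
      · exact Or.inl (hP.eq_of_mem hr hp h.1 hu)
      · exact Or.inr (hP.eq_of_mem hr hq h.1 hv)
    have := (Finset.card_le_card hsub).trans Finset.card_le_two
    rw [if_pos hcut]
    omega
  · have hnot : ∀ p ∈ P, ∀ q ∈ P, G.Adj u v → u ∈ p → v ∈ q → p = q := by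
      intro p hp q hq hadj hu hv
      by_contra hne
      exact hcut (mem_partitionCut_mk.mpr ⟨hadj, p, hp, q, hq, hne, hu, hv⟩)
    rw [if_neg hcut]
    by_cases hS : s(u, v) ∈ cutEdges G S
    · rw [if_pos hS, mul_zero, add_zero, Finset.card_le_one]
      intro p hp q hq
      simp only [Finset.mem_filter, mem_cutEdges_mk] at hp hq
      have hu := hP.eq_of_mem (u := u) hp.1 hq.1
      have hv := hP.eq_of_mem (u := v) hp.1 hq.1
      have hpq := hnot p hp.1 q hq.1
      have hqp := hnot q hq.1 p hp.1
      grind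
    · rw [if_neg hS, mul_zero, add_zero, Nat.le_zero, Finset.card_eq_zero,
        Finset.filter_eq_empty_iff]
      intro p hp hpe
      rw [mem_cutEdges_mk, hP.mem_iff, hP.mem_iff] at hS
      rw [mem_cutEdges_mk] at hpe
      grind

theorem IsPartitionOf.sum_cutEdges_le [Fintype V] (G : SimpleGraph V) {x : Sym2 V → ℝ}
    (hx : ∀ e, 0 ≤ x e) {S : Set V} {P : Finset (Set V)} (hP : IsPartitionOf S P) :
    ∑ p ∈ P, ∑ e ∈ cutEdges G p, x e ≤
      ∑ e ∈ cutEdges G S, x e + 2 * ∑ e ∈ partitionCut G P, x e := by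
  have hind : ∀ F : Finset (Sym2 V), ∑ e ∈ F, x e = ∑ e, (if e ∈ F then 1 else 0) * x e := by
    intro F
    simp
  simp only [hind]
  rw [Finset.sum_comm, Finset.mul_sum, ← Finset.sum_add_distrib]
  refine Finset.sum_le_sum fun e _ => ?_
  rw [← Finset.sum_mul, ← mul_assoc, ← add_mul, Finset.sum_boole]
  refine mul_le_mul_of_nonneg_right ?_ (hx e)
  exact_mod_cast hP.card_filter_mem_cutEdges_le G e

/-- bound on the total cut value of the parts of a cheap partition. -/
theorem sum_cut_parts_le [Fintype V] (G : SimpleGraph V)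
    (x : Sym2 V → ℝ) (hx : ∀ e, 0 ≤ x e) (η : ℝ) (hη : 2 < η)
    (S : Set V) (P : Finset (Set V)) (hP : IsPartitionOf S P)
    (hcheap : η * (∑ e ∈ partitionCut G P, x e) ≤ (P.card : ℝ) - 1)
    (hparts : ∀ p ∈ P, 1 ≤ ∑ e ∈ cutEdges G p, x e) :
    ∑ p ∈ P, (∑ e ∈ cutEdges G p, x e) ≤
      (1 / (1 - 2 / η)) * (∑ e ∈ cutEdges G S, x e) - 2 / (η - 2) := by
  have hsum := hP.sum_cutEdges_le G hx
  have hcard : (P.card : ℝ) ≤ ∑ p ∈ P, ∑ e ∈ cutEdges G p, x e := by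
    simpa using Finset.sum_le_sum hparts
  set A := ∑ p ∈ P, ∑ e ∈ cutEdges G p, x e
  set C := ∑ e ∈ cutEdges G S, x e
  set I := ∑ e ∈ partitionCut G P, x e
  have hη' : 0 < η - 2 := by linarith
  have hη₀ : 0 < η := by linarith
  have hrhs : 1 / (1 - 2 / η) * C - 2 / (η - 2) = (η * C - 2) / (η - 2) := by
    have : 1 - 2 / η = (η - 2) / η := by field_simp
    rw [this, one_div_div]
    ring
  rw [hrhs, le_div_iff₀ hη']
  nlinarith [mul_le_mul_of_nonneg_left hsum hη₀.le]
end
end
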